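/- Let k be a field of characteristic ≠ 2 and a, b, c, d ∈ k×. The conic function fields k(C_{a,b}) and k(C_{c,d}) are isomorphic as k-algebras if and only if the quaternion algebras ℍ(a,b) and ℍ(c,d) are isomorphic as k-algebras. -/

import Mathlib

open scoped TensorProduct
open Quaternion
set_option synthInstance.maxHeartbeats 1000000
set_option maxHeartbeats 1000000
noncomputable section

universe u v

/-- Upper-triangular coefficient matrix of a quadratic form on `Fin n → R`. -/
def coeffMatrix {R : Type*} [CommRing R] {n : ℕ} (q : QuadraticForm R (Fin n → R)) :
    Matrix (Fin n) (Fin n) R :=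
  Matrix.of fun i j =>
    if i = j then q (Pi.single i 1)
    else if i < j then QuadraticMap.polar q (Pi.single i 1) (Pi.single j 1)
    else 0

/-- Base change of a quadratic form on `Fin n → R` along `R → l`. -/
def extendQF {R : Type*} [CommRing R] {n : ℕ} (q : QuadraticForm R (Fin n → R))
    (l : Type*) [CommRing l] [Algebra R l] : QuadraticForm l (Fin n → l) :=
  ((coeffMatrix q).map (algebraMap R l)).toQuadraticMap'

/-- Gram matrix of the polar bilinear form of `q`. -/
def polarMatrix {R : Type*} [CommRing R] {n : ℕ} (q : QuadraticForm R (Fin n → R)) :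
    Matrix (Fin n) (Fin n) R :=
  Matrix.of fun i j => QuadraticMap.polar q (Pi.single i 1) (Pi.single j 1)

/-- Discriminant: determinant of the Gram matrix (well defined up to squares). -/
def discQF {R : Type*} [CommRing R] {n : ℕ} (q : QuadraticForm R (Fin n → R)) : R :=
  (polarMatrix q).det

/-- Nondegeneracy (char ≠ 2): the Gram determinant is nonzero. -/
def NondegQF {R : Type*} [CommRing R] {n : ℕ} (q : QuadraticForm R (Fin n → R)) : Prop :=
  discQF q ≠ 0

/-- Two quadratic forms are similar if one is isometric to a unit scaling of the other. -/
def SimilarQF {R : Type*} [CommRing R] {n : ℕ} (q q' : QuadraticForm R (Fin n → R)) : Prop :=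
  ∃ c : R, IsUnit c ∧ QuadraticMap.Equivalent (c • q) q'

/-- The polynomial `q(X₁, …, X_{n-1}, 1)` defining the affine quadric. -/
def affineQuadricPoly {R : Type*} [CommRing R] {n : ℕ} (q : QuadraticForm R (Fin n → R)) :
    MvPolynomial (Fin (n - 1)) R :=
  (extendQF q (MvPolynomial (Fin (n - 1)) R))
    (fun i => if h : (i : ℕ) < n - 1 then MvPolynomial.X ⟨i, h⟩ else 1)

/-- Affine coordinate ring `R[x₁,…,x_{n-1}]/(q(x₁,…,x_{n-1},1))` of the quadric. -/
abbrev quadricCoordRing {R : Type*} [CommRing R] {n : ℕ}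
    (q : QuadraticForm R (Fin n → R)) : Type _ :=
  MvPolynomial (Fin (n - 1)) R ⧸ Ideal.span {affineQuadricPoly q}

/-- Function field `k(q)` of the quadric hypersurface `q = 0`. -/
abbrev quadricFunctionField {R : Type*} [CommRing R] {n : ℕ}
    (q : QuadraticForm R (Fin n → R)) : Type _ :=
  FractionRing (quadricCoordRing q)

/-- Affine coordinate ring `k[x,y]/(ax²+by²-1)` of the conic `C_{a,b}`. -/
abbrev conicCoordRing (k : Type*) [Field k] (a b : k) : Type _ :=
  MvPolynomial (Fin 2) k ⧸
    Ideal.span {(MvPolynomial.C a * MvPolynomial.X 0 ^ 2 +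
      MvPolynomial.C b * MvPolynomial.X 1 ^ 2 - 1 : MvPolynomial (Fin 2) k)}

/-- The conic function field `k(C_{a,b})`. -/
abbrev conicFunctionField (k : Type*) [Field k] (a b : k) : Type _ :=
  FractionRing (conicCoordRing k a b)

/-- A `k`-algebra is split if it is isomorphic to a matrix algebra over `k`. -/
def IsSplitAlg (k A : Type*) [Field k] [Ring A] [Algebra k A] : Prop :=
  ∃ n : ℕ, 0 < n ∧ Nonempty (A ≃ₐ[k] Matrix (Fin n) (Fin n) k)

/-- `A` is split by the extension `K/k`: the class of `A` lies in the Brauer kernel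
`κ(K/k) = ker (Br k → Br K)`. -/
def SplitsIn (k : Type*) [Field k] (A : Type*) [Ring A] [Algebra k A]
    (K : Type*) [CommRing K] [Algebra k K] : Prop :=
  ∃ n : ℕ, 0 < n ∧ Nonempty ((K ⊗[k] A) ≃ₐ[K] Matrix (Fin n) (Fin n) K)

/-- Brauer equivalence of two `k`-algebras. -/
def BrauerEquiv (k A B : Type*) [Field k] [Ring A] [Algebra k A] [Ring B] [Algebra k B] :
    Prop :=
  ∃ n m : ℕ, 0 < n ∧ 0 < m ∧
    Nonempty (Matrix (Fin n) (Fin n) A ≃ₐ[k] Matrix (Fin m) (Fin m) B)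

/-- A field is finitely generated (over its prime subfield). -/
def FieldFG (K : Type*) [Field K] : Prop :=
  ∃ s : Finset K, Subfield.closure (s : Set K) = ⊤

/-- Elementary equivalence in the first-order language of rings. -/
def ElemEquivRing (K₁ : Type*) (K₂ : Type*) [CommRing K₁] [CommRing K₂] : Prop :=
  letI := FirstOrder.Ring.compatibleRingOfRing K₁
  letI := FirstOrder.Ring.compatibleRingOfRing K₂
  FirstOrder.Language.ring.ElementarilyEquivalent K₁ K₂

/-- The `m`-fold Pfister form `⟨⟨a₁,…,aₘ⟩⟩ = ⟨1,a₁⟩ ⊗ ⋯ ⊗ ⟨1,aₘ⟩`. -/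
def pfisterForm {k : Type*} [Field k] {m : ℕ} (a : Fin m → k) :
    QuadraticForm k (Fin (2 ^ m) → k) :=
  QuadraticMap.weightedSumSquares k
    (fun j : Fin (2 ^ m) => ∏ i : Fin m, if Nat.testBit (j : ℕ) (i : ℕ) then a i else 1)

/-- The form `⟨c, d, -cd⟩`, i.e. the squaring map on pure quaternions of `ℍ(c,d)`. -/
def pureSq {R : Type*} [CommRing R] (c d : R) (v : Fin 3 → R) : R :=
  c * v 0 ^ 2 + d * v 1 ^ 2 - c * d * v 2 ^ 2

/-- The symmetric bilinear form with `pureBilin c d v v = pureSq c d v`. -/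
def pureBilin {R : Type*} [CommRing R] (c d : R) (v w : Fin 3 → R) : R :=
  c * v 0 * w 0 + d * v 1 * w 1 - c * d * v 2 * w 2

/-- The imaginary part of the product of two pure quaternions of `ℍ(c,d)`. -/
def pureCross {R : Type*} [CommRing R] (c d : R) (v w : Fin 3 → R) : Fin 3 → R :=
  ![d * (v 2 * w 1 - v 1 * w 2), c * (v 0 * w 2 - v 2 * w 0), v 0 * w 1 - v 1 * w 0]

/-- The form `⟨c, d, -cd⟩` has no nontrivial zeros. -/
def PureAnisotropic {k : Type*} [Field k] (c d : k) : Prop :=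
  ∀ v : Fin 3 → k, pureSq c d v = 0 → v = 0

/-- `ℍ(c,d)` contains anticommuting pure quaternions with squares `a` and `b`. -/
def HasPurePair {k : Type*} [Field k] (a b c d : k) : Prop :=
  ∃ u v : Fin 3 → k, pureSq c d u = a ∧ pureSq c d v = b ∧ pureBilin c d u v = 0

section PureForm

variable {R : Type*} [CommRing R] (c d : R) (v w : Fin 3 → R)

theorem pureSq_add_smul (t : R) :
    pureSq c d (v + t • w) = pureSq c d v + 2 * t * pureBilin c d v w + t ^ 2 * pureSq c d w := by
  simp only [pureSq, pureBilin, Pi.add_apply, Pi.smul_apply, smul_eq_mul]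
  ring

theorem pureSq_smul (t : R) : pureSq c d (t • v) = t ^ 2 * pureSq c d v := by
  simp only [pureSq, Pi.smul_apply, smul_eq_mul]
  ring

theorem pureSq_pureCross :
    pureSq c d (pureCross c d v w) = pureBilin c d v w ^ 2 - pureSq c d v * pureSq c d w := by
  simp only [pureSq, pureBilin, pureCross, Matrix.cons_val]
  ring

theorem pureBilin_pureCross_left : pureBilin c d (pureCross c d v w) v = 0 := by
  simp only [pureBilin, pureCross, Matrix.cons_val]
  ring

theorem pureBilin_pureCross_right : pureBilin c d (pureCross c d v w) w = 0 := by
  simp only [pureBilin, pureCross, Matrix.cons_val]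
  ring

end PureForm

section Quaternion

variable {k : Type*} [Field k] {a b c d : k}

theorem injective_liftHom (h2 : (2 : k) ≠ 0) (ha : a ≠ 0) (hb : b ≠ 0) {A : Type*} [Ring A]
    [Nontrivial A] [Algebra k A] (B : QuaternionAlgebra.Basis A a 0 b) :
    Function.Injective B.liftHom := by
  have key : ∀ z : ℍ[k,a,b], B.liftHom z = 0 → z.re = 0 := by
    intro z hz
    set I : ℍ[k,a,b] := ⟨0, 1, 0, 0⟩
    set J : ℍ[k,a,b] := ⟨0, 0, 1, 0⟩
    have h1 : B.liftHom (I * z + z * I) = 0 := by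
      rw [map_add, map_mul, map_mul, hz, mul_zero, zero_mul, add_zero]
    have h3 : B.liftHom (J * (I * (I * z + z * I)) + (I * (I * z + z * I)) * J) = 0 := by
      rw [map_add, map_mul _ J, map_mul _ _ J, map_mul _ I, h1, mul_zero, mul_zero, zero_mul,
        add_zero]
    have h4 : B.liftHom (J * (J * (I * (I * z + z * I)) + (I * (I * z + z * I)) * J)) = 0 := by
      rw [map_mul, h3, mul_zero]
    obtain ⟨r, hr⟩ : ∃ r, r = 4 * a * b * z.re := ⟨_, rfl⟩
    have h5 : J * (J * (I * (I * z + z * I)) + (I * (I * z + z * I)) * J) =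
        algebraMap k _ r := by
      ext
      · simp [I, J]
        rw [hr]
        ring
      all_goals simp [I, J]
    rw [h5, AlgHom.commutes, map_eq_zero_iff _ (algebraMap k A).injective, hr] at h4
    have h4' : (4 : k) ≠ 0 := by
      have : (4 : k) = 2 * 2 := by norm_num
      rw [this]; exact mul_ne_zero h2 h2
    simpa [h4', ha, hb] using h4
  rw [injective_iff_map_eq_zero]
  intro z hz
  have hI := key ((⟨0, 1, 0, 0⟩ : ℍ[k,a,b]) * z) (by rw [map_mul, hz, mul_zero])
  have hJ := key ((⟨0, 0, 1, 0⟩ : ℍ[k,a,b]) * z) (by rw [map_mul, hz, mul_zero])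
  have hK := key ((⟨0, 0, 0, 1⟩ : ℍ[k,a,b]) * z) (by rw [map_mul, hz, mul_zero])
  ext
  · simpa using key z hz
  · simpa [ha] using hI
  · simpa [hb] using hJ
  · simpa [ha, hb] using hK

theorem HasPurePair.nonempty_algEquiv (h2 : (2 : k) ≠ 0) (ha : a ≠ 0) (hb : b ≠ 0)
    (h : HasPurePair a b c d) : Nonempty (ℍ[k,a,b] ≃ₐ[k] ℍ[k,c,d]) := by
  obtain ⟨u, v, hu, hv, huv⟩ := h
  simp only [pureSq, pureBilin] at hu hv huv
  let I : ℍ[k,c,d] := ⟨0, u 0, u 1, u 2⟩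
  let J : ℍ[k,c,d] := ⟨0, v 0, v 1, v 2⟩
  let B : QuaternionAlgebra.Basis ℍ[k,c,d] a 0 b :=
    { i := I
      j := J
      k := I * J
      i_mul_i := by
        rw [← hu]
        ext <;> simp [I] <;> ring
      j_mul_j := by
        rw [← hv]
        ext <;> simp [J] <;> ring
      i_mul_j := rfl
      j_mul_i := by
        ext <;> simp [I, J]
        · linear_combination 2 * huv
        all_goals ring }
  have hinj := injective_liftHom h2 ha hb B
  refine ⟨AlgEquiv.ofBijective B.liftHom ⟨hinj, ?_⟩⟩
  exact (LinearMap.injective_iff_surjective_of_finrank_eq_finrank (f := B.liftHom.toLinearMap)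
    (by rw [QuaternionAlgebra.finrank_eq_four, QuaternionAlgebra.finrank_eq_four])).1 hinj

theorem re_eq_zero_of_anticommute (h2 : (2 : k) ≠ 0) (hb : b ≠ 0) {x y : ℍ[k,c,d]}
    (hxy : x * y = -(y * x)) (hy : y * y = algebraMap k _ b) : x.re = 0 := by
  have h1 : (x * (y * y)).re = -(y * (x * y)).re := by
    rw [← mul_assoc y, ← neg_eq_iff_eq_neg.2 hxy, neg_mul, mul_assoc, QuaternionAlgebra.re_neg,
      neg_neg]
  have h3 : (y * (x * y)).re = (x * (y * y)).re := by
    simp; ring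
  rw [h3, hy] at h1
  have h4 : 2 * (x.re * b) = 0 := by
    simp at h1
    linear_combination h1
  simpa [h2, hb] using h4

theorem hasPurePair_of_algEquiv (h2 : (2 : k) ≠ 0) (ha : a ≠ 0) (hb : b ≠ 0)
    (f : ℍ[k,a,b] ≃ₐ[k] ℍ[k,c,d]) : HasPurePair a b c d := by
  set I : ℍ[k,a,b] := ⟨0, 1, 0, 0⟩ with hI
  set J : ℍ[k,a,b] := ⟨0, 0, 1, 0⟩ with hJ
  have hII : f I * f I = algebraMap k _ a := by
    rw [← map_mul, ← f.commutes]
    congr 1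
    ext <;> simp [I]
  have hJJ : f J * f J = algebraMap k _ b := by
    rw [← map_mul, ← f.commutes]
    congr 1
    ext <;> simp [J]
  have hIJ : f I * f J = -(f J * f I) := by
    rw [← map_mul, ← map_mul, ← map_neg]
    congr 1
    ext <;> simp [I, J]
  have hI0 : (f I).re = 0 := re_eq_zero_of_anticommute h2 hb hIJ hJJ
  have hJ0 : (f J).re = 0 := re_eq_zero_of_anticommute h2 ha (by rw [hIJ, neg_neg]) hII
  refine ⟨![(f I).imI, (f I).imJ, (f I).imK], ![(f J).imI, (f J).imJ, (f J).imK], ?_, ?_, ?_⟩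
  · have := congrArg QuaternionAlgebra.re hII
    simp [hI0] at this
    simp [pureSq]
    linear_combination this
  · have := congrArg QuaternionAlgebra.re hJJ
    simp [hJ0] at this
    simp [pureSq]
    linear_combination this
  · have := congrArg QuaternionAlgebra.re hIJ
    simp [hI0, hJ0] at this
    have h3 : 2 * pureBilin c d ![(f I).imI, (f I).imJ, (f I).imK]
        ![(f J).imI, (f J).imJ, (f J).imK] = 0 := by
      simp only [pureBilin, Matrix.cons_val]
      linear_combination this
    simpa [h2] using h3

theorem hasPurePair_one_neg_one (h2 : (2 : k) ≠ 0) (hc : c ≠ 0) (hd : d ≠ 0)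
    (h : ¬ PureAnisotropic c d) : HasPurePair 1 (-1) c d := by
  simp only [PureAnisotropic, not_forall] at h
  obtain ⟨z, hz, hz0⟩ := h
  obtain ⟨y, hy⟩ : ∃ y, pureBilin c d z y = 1 := by
    obtain ⟨i, hi⟩ := Function.ne_iff.1 hz0
    simp only [Pi.zero_apply] at hi
    fin_cases i <;> simp at hi
    · exact ⟨![(c * z 0)⁻¹, 0, 0], by simp [pureBilin]; field_simp⟩
    · exact ⟨![0, (d * z 1)⁻¹, 0], by simp [pureBilin]; field_simp⟩
    · exact ⟨![0, 0, -(c * d * z 2)⁻¹], by simp [pureBilin]; field_simp⟩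
  have hpair : ∀ s t : k, pureBilin c d (z + s • (y + t • z)) (z - s • (y + t • z)) =
      pureSq c d z - s ^ 2 * pureSq c d (y + t • z) := by
    intro s t
    simp [pureBilin, pureSq]; ring
  obtain ⟨t, ht⟩ : ∃ t : k, pureSq c d (y + t • z) = 0 ∧ pureBilin c d z (y + t • z) = 1 := by
    refine ⟨-pureSq c d y / 2, ?_, ?_⟩
    · have : pureBilin c d y z = 1 := by rw [← hy]; simp only [pureBilin]; ring
      rw [pureSq_add_smul, hz, this]; field_simp; ring
    · have : pureBilin c d z (y + (-pureSq c d y / 2) • z) =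
          pureBilin c d z y + (-pureSq c d y / 2) * pureSq c d z := by
        simp [pureBilin, pureSq]; ring
      rw [this, hz, hy]; ring
  refine ⟨z + (1 / 2 : k) • (y + t • z), z + (-1 / 2 : k) • (y + t • z), ?_, ?_, ?_⟩
  · rw [pureSq_add_smul, hz, ht.1, ht.2]; field_simp; ring
  · rw [pureSq_add_smul, hz, ht.1, ht.2]; field_simp; ring
  · have := hpair (1 / 2) t
    rw [hz, ht.1] at this
    rw [neg_div, neg_smul, ← sub_eq_add_neg, this]; ring

end Quaternion
section CasselsPfister

open Polynomial

variable {k : Type*} [Field k] {a b c d : k}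

theorem coeff_pureSq (v : Fin 3 → k[X]) (n : ℕ) (hv : ∀ i, (v i).natDegree ≤ n) :
    (pureSq (C c) (C d) v).coeff (2 * n) = pureSq c d (fun i => (v i).coeff n) := by
  simp only [pureSq, mul_assoc, coeff_sub, coeff_add, coeff_C_mul,
    coeff_pow_of_natDegree_le (hv _)]

theorem natDegree_pureSq_le (v : Fin 3 → k[X]) (n : ℕ) (hv : ∀ i, (v i).natDegree ≤ n) :
    (pureSq (C c) (C d) v).natDegree ≤ 2 * n := by
  have h : ∀ i, ((v i) ^ 2).natDegree ≤ 2 * n := fun i => natDegree_pow_le_of_le 2 (hv i)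
  simp only [pureSq, mul_assoc]
  refine (natDegree_sub_le _ _).trans (max_le (natDegree_add_le_of_degree_le ?_ ?_) ?_)
  · exact (natDegree_C_mul_le _ _).trans (h 0)
  · exact (natDegree_C_mul_le _ _).trans (h 1)
  · exact (natDegree_C_mul_le _ _).trans ((natDegree_C_mul_le _ _).trans (h 2))

/-- Leading terms of an anisotropic form do not cancel. -/
theorem PureAnisotropic.coeff_eq_zero (h : PureAnisotropic c d) (v : Fin 3 → k[X]) (m : ℕ)
    (hm : ∀ j, m ≤ j → (pureSq (C c) (C d) v).coeff (2 * j) = 0) (j : ℕ) (hj : m ≤ j)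
    (i : Fin 3) : (v i).coeff j = 0 := by
  by_contra hij
  obtain ⟨l, -, hl⟩ := Finset.exists_max_image Finset.univ (fun i => (v i).natDegree) ⟨i, by simp⟩
  have hjn : j ≤ (v l).natDegree := (le_natDegree_of_ne_zero hij).trans (hl i (Finset.mem_univ _))
  have hcoeff := coeff_pureSq (c := c) (d := d) v (v l).natDegree
    (fun i => hl i (Finset.mem_univ _))
  rw [hm _ (hj.trans hjn)] at hcoeff
  have h0 := h _ hcoeff.symm
  have hvl : v l = 0 := leadingCoeff_eq_zero.1 (congrFun h0 l)
  have hj0 : j = (v l).natDegree := by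
    rw [hvl, natDegree_zero] at hjn ⊢
    omega
  exact hij (hj0 ▸ congrFun h0 i)

theorem PureAnisotropic.polynomial (h : PureAnisotropic c d) {v : Fin 3 → k[X]}
    (hv : pureSq (C c) (C d) v = 0) : v = 0 := by
  ext i j
  exact h.coeff_eq_zero v 0 (by simp [hv]) j (Nat.zero_le j) i

/-- The Cassels–Pfister descent for the anisotropic form `⟨c, d, -cd⟩`. -/
theorem PureAnisotropic.exists_polynomial (h : PureAnisotropic c d) (δ : k[X]) (p : k[X])
    (hp : p ≠ 0) (w : Fin 3 → k[X]) (hw : pureSq (C c) (C d) w = p ^ 2 * δ) :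
    ∃ s, pureSq (C c) (C d) s = δ := by
  induction hn : p.natDegree using Nat.strong_induction_on generalizing p w with
  | _ n ih =>
  let s : Fin 3 → k[X] := fun i => w i / p
  let r : Fin 3 → k[X] := fun i => w i % p
  have hwsr : w = r + p • s := by
    ext1 i
    simp only [r, s, Pi.add_apply, Pi.smul_apply, smul_eq_mul]
    rw [add_comm, EuclideanDomain.div_add_mod]
  by_cases hr : r = 0
  · refine ⟨s, mul_left_cancel₀ (pow_ne_zero 2 hp) ?_⟩
    rw [← hw, hwsr, hr, zero_add, pureSq_smul]
  · set p' : k[X] := p * δ - 2 * pureBilin (C c) (C d) w s + p * pureSq (C c) (C d) s with hp'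
    have hpp' : p * p' = pureSq (C c) (C d) r := by
      have : r = w + (-p) • s := by rw [hwsr]; simp
      rw [this, pureSq_add_smul, hw, hp']
      ring
    have hqr : pureSq (C c) (C d) r ≠ 0 := fun h0 => hr (h.polynomial h0)
    have hp'0 : p' ≠ 0 := by
      rintro h0
      rw [h0, mul_zero] at hpp'
      exact hqr hpp'.symm
    have hpd : p.natDegree ≠ 0 := by
      intro h0
      apply hr
      ext1 i
      rw [natDegree_eq_zero] at h0
      obtain ⟨x, rfl⟩ := h0
      exact EuclideanDomain.mod_eq_zero.2
        ((isUnit_C.2 (isUnit_iff_ne_zero.2 (by simpa using hp))).dvd)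
    have hdeg : p'.natDegree < n := by
      have h1 := natDegree_pureSq_le (c := c) (d := d) r (p.natDegree - 1)
        (fun i => Nat.le_sub_one_of_lt (natDegree_mod_lt (w i) hpd))
      rw [← hpp', natDegree_mul hp hp'0] at h1
      omega
    refine ih _ hdeg p' hp'0 (p' • s + (pureSq (C c) (C d) s - δ) • r) ?_ rfl
    rw [pureSq_add_smul, pureSq_smul, ← hpp']
    have h3 : pureBilin (C c) (C d) (p' • s) r =
        p' * (pureBilin (C c) (C d) w s - p * pureSq (C c) (C d) s) := by
      rw [hwsr]
      simp only [pureBilin, pureSq, Pi.add_apply, Pi.smul_apply, smul_eq_mul]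
      ring
    rw [h3]
    generalize pureSq (C c) (C d) s = Q at *
    generalize pureBilin (C c) (C d) w s = B at *
    rw [hp']
    ring

theorem PureAnisotropic.hasPurePair_of_polynomial (h2 : (2 : k) ≠ 0) (hb : b ≠ 0)
    (h : PureAnisotropic c d) (s : Fin 3 → k[X])
    (hs : pureSq (C c) (C d) s = C b⁻¹ * (1 - C a * X ^ 2)) : HasPurePair a b c d := by
  have hcoeff := h.coeff_eq_zero s 2 (by
    intro j hj
    rw [hs, coeff_C_mul, coeff_sub, coeff_C_mul, coeff_X_pow, coeff_one, if_neg (by omega),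
      if_neg (by omega)]
    simp)
  have hlin : s = fun i => C ((s i).coeff 0) + C ((s i).coeff 1) * X := by
    ext1 i
    rw [add_comm]
    exact eq_X_add_C_of_natDegree_le_one
      (natDegree_le_iff_coeff_eq_zero.2 fun j hj => hcoeff j hj i)
  set u : Fin 3 → k := fun i => (s i).coeff 0
  set t : Fin 3 → k := fun i => (s i).coeff 1
  have hexp : pureSq (C c) (C d) s =
      C (pureSq c d u) + C (2 * pureBilin c d u t) * X + C (pureSq c d t) * X ^ 2 := by
    rw [hlin]
    simp only [pureSq, pureBilin, map_add, map_sub, map_mul, map_pow, u, t, map_ofNat]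
    ring
  rw [hs] at hexp
  have h0 := congrArg (coeff · 0) hexp
  have h1 := congrArg (coeff · 1) hexp
  have h3 := congrArg (coeff · 2) hexp
  simp [coeff_one, coeff_X] at h0 h1 h3
  have hut : pureBilin c d u t = 0 := by simpa [h2] using h1.symm
  refine ⟨b • pureCross c d u t, b • u, ?_, ?_, ?_⟩
  · rw [pureSq_smul, pureSq_pureCross, hut, ← h0, ← h3]
    field_simp
    ring
  · rw [pureSq_smul, ← h0]
    field_simp
  · have := pureBilin_pureCross_left c d u t
    simp only [pureBilin, Pi.smul_apply, smul_eq_mul] at this ⊢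
    linear_combination b ^ 2 * this

/-- A zero of `⟨c, d, -cd⟩` over the quadratic extension of `k[X]` by a root of
`(1 - a X ^ 2) / b`, in coordinates `v + w √((1 - a X ^ 2) / b)`. -/
theorem PureAnisotropic.hasPurePair (h2 : (2 : k) ≠ 0) (hb : b ≠ 0)
    (h : PureAnisotropic c d) (v w : Fin 3 → k[X]) (hvw : v ≠ 0 ∨ w ≠ 0)
    (hq : pureSq (C c) (C d) v + C b⁻¹ * (1 - C a * X ^ 2) * pureSq (C c) (C d) w = 0)
    (hB : pureBilin (C c) (C d) v w = 0) : HasPurePair a b c d := by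
  have hw : pureSq (C c) (C d) w ≠ 0 := by
    intro h0
    rw [h0, mul_zero, add_zero] at hq
    exact hvw.elim (· (h.polynomial hq)) (· (h.polynomial h0))
  obtain ⟨s, hs⟩ := h.exists_polynomial (C b⁻¹ * (1 - C a * X ^ 2)) _ hw
    (pureCross (C c) (C d) v w) (by
      rw [pureSq_pureCross, hB]
      linear_combination -pureSq (C c) (C d) w * hq)
  exact h.hasPurePair_of_polynomial h2 hb s hs

end CasselsPfister
section ConicRing

open Polynomial

variable {k : Type*} [Field k] {a b c d : k}

/-- The coordinate function `x` on the affine conic. -/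
def conicX (k : Type*) [Field k] (a b : k) : conicCoordRing k a b :=
  Ideal.Quotient.mk _ (MvPolynomial.X 0)

/-- The coordinate function `y` on the affine conic. -/
def conicY (k : Type*) [Field k] (a b : k) : conicCoordRing k a b :=
  Ideal.Quotient.mk _ (MvPolynomial.X 1)

theorem conic_equation : algebraMap k _ a * conicX k a b ^ 2 +
    algebraMap k _ b * conicY k a b ^ 2 = 1 := by
  have h : Ideal.Quotient.mk (Ideal.span {(MvPolynomial.C a * MvPolynomial.X 0 ^ 2 +
      MvPolynomial.C b * MvPolynomial.X 1 ^ 2 - 1 : MvPolynomial (Fin 2) k)}) _ = 0 :=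
    Ideal.Quotient.eq_zero_iff_mem.2 (Ideal.mem_span_singleton_self _)
  rw [map_sub, map_add, map_mul, map_mul, map_pow, map_pow, map_one, sub_eq_zero] at h
  exact h

/-- The point `(x, y)` of the affine conic in `L`, as a map out of the coordinate ring. -/
def conicLift {L : Type*} [CommRing L] [Algebra k L] (x y : L)
    (h : algebraMap k L a * x ^ 2 + algebraMap k L b * y ^ 2 = 1) :
    conicCoordRing k a b →ₐ[k] L :=
  Ideal.Quotient.liftₐ _ (MvPolynomial.aeval ![x, y]) (by
    intro z hz
    obtain ⟨w, rfl⟩ := Ideal.mem_span_singleton'.1 hz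
    rw [map_mul]
    simp [h])

section Lift

variable {L : Type*} [CommRing L] [Algebra k L] (x y : L)
  (h : algebraMap k L a * x ^ 2 + algebraMap k L b * y ^ 2 = 1)

theorem conicLift_conicX : conicLift x y h (conicX k a b) = x := by
  simp only [conicLift, conicX]
  erw [Ideal.Quotient.lift_mk]
  simp

theorem conicLift_conicY : conicLift x y h (conicY k a b) = y := by
  simp only [conicLift, conicY]
  erw [Ideal.Quotient.lift_mk]
  simp

end Lift

theorem conicCoordRing_algHom_ext {L : Type*} [CommRing L] [Algebra k L]
    {f g : conicCoordRing k a b →ₐ[k] L} (hx : f (conicX k a b) = g (conicX k a b))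
    (hy : f (conicY k a b) = g (conicY k a b)) : f = g := by
  apply Ideal.Quotient.algHom_ext
  apply MvPolynomial.algHom_ext
  intro i
  fin_cases i
  · exact hx
  · exact hy

/-- The polynomial `Y ^ 2 - (1 - a X ^ 2) / b` over `k[X]`. -/
def conicPoly (a b : k) : k[X][X] := X ^ 2 - C (C b⁻¹ * (1 - C a * X ^ 2))

theorem conicPoly_monic : (conicPoly a b).Monic := monic_X_pow_sub_C _ two_ne_zero

theorem conicPoly_natDegree : (conicPoly a b).natDegree = 2 := natDegree_X_pow_sub_C

theorem sq_ne_conic (h2 : (2 : k) ≠ 0) (ha : a ≠ 0) (hb : b ≠ 0) (r : k[X]) :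
    r ^ 2 ≠ C b⁻¹ * (1 - C a * X ^ 2) := by
  intro hr
  have hdeg : r.natDegree ≤ 1 := by
    have h1 : (C b⁻¹ * (1 - C a * X ^ 2)).natDegree ≤ 2 := by compute_degree
    rw [← hr, natDegree_pow] at h1
    omega
  rw [eq_X_add_C_of_natDegree_le_one hdeg] at hr
  set u := r.coeff 1
  set v := r.coeff 0
  have hexp : (C u * X + C v) ^ 2 = C (v ^ 2) + C (2 * u * v) * X + C (u ^ 2) * X ^ 2 := by
    simp only [map_mul, map_pow, map_ofNat]
    ring
  rw [hexp] at hr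
  have h0 := congrArg (coeff · 0) hr
  have h1 := congrArg (coeff · 1) hr
  have h3 := congrArg (coeff · 2) hr
  simp [-map_pow, coeff_one, coeff_X, coeff_C, coeff_X_pow] at h0 h1 h3
  have hv : v ≠ 0 := by
    rintro hv
    exact hb (by simpa [hv] using h0.symm)
  have hu : u ≠ 0 := by
    rintro hu
    simp [hu, hb, ha] at h3
  simp [h2, hu, hv] at h1

theorem conicPoly_prime (h2 : (2 : k) ≠ 0) (ha : a ≠ 0) (hb : b ≠ 0) :
    Prime (conicPoly a b) := by
  refine Irreducible.prime ?_
  rw [conicPoly_monic.irreducible_iff_roots_eq_zero_of_degree_le_three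
    conicPoly_natDegree.ge (by rw [conicPoly_natDegree]; omega)]
  refine Multiset.eq_zero_of_forall_notMem fun r hr => ?_
  have := isRoot_of_mem_roots hr
  simp only [conicPoly, IsRoot, eval_sub, eval_pow, eval_X, eval_C, sub_eq_zero] at this
  exact sq_ne_conic h2 ha hb r this

theorem conic_sq_eq {L : Type*} [CommRing L] [Algebra k L] {x y : L} (hb : b ≠ 0)
    (h : algebraMap k L a * x ^ 2 + algebraMap k L b * y ^ 2 = 1) :
    y ^ 2 = aeval x (C b⁻¹ * (1 - C a * X ^ 2)) := by
  have hbb : algebraMap k L b⁻¹ * algebraMap k L b = 1 := by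
    rw [← map_mul, inv_mul_cancel₀ hb, map_one]
  simp
  linear_combination algebraMap k L b⁻¹ * h - y ^ 2 * hbb

theorem adjoinRoot_conic_equation (hb : b ≠ 0) :
    algebraMap k (AdjoinRoot (conicPoly a b)) a * AdjoinRoot.of (conicPoly a b) X ^ 2 +
      algebraMap k _ b * AdjoinRoot.root (conicPoly a b) ^ 2 = 1 := by
  have h1 : AdjoinRoot.mk (conicPoly a b) (X ^ 2 - C (C b⁻¹ * (1 - C a * X ^ 2))) = 0 :=
    AdjoinRoot.mk_self
  have hbb : AdjoinRoot.of (conicPoly a b) (C b) * AdjoinRoot.of (conicPoly a b) (C b⁻¹) =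
      1 := by
    rw [← map_mul, ← C_mul, mul_inv_cancel₀ hb, C_1, map_one]
  simp only [map_sub, map_pow, AdjoinRoot.mk_X, AdjoinRoot.mk_C, map_mul,
    map_one] at h1
  change AdjoinRoot.of (conicPoly a b) (C a) * _ + AdjoinRoot.of (conicPoly a b) (C b) * _ = 1
  linear_combination AdjoinRoot.of (conicPoly a b) (C b) * h1 +
    (1 - AdjoinRoot.of (conicPoly a b) (C a) * AdjoinRoot.of (conicPoly a b) X ^ 2) * hbb

/-- The coordinate ring of a conic as a quadratic extension of `k[X]`. -/
def conicEquiv (hb : b ≠ 0) : conicCoordRing k a b ≃ₐ[k] AdjoinRoot (conicPoly a b) :=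
  AlgEquiv.ofAlgHom
    (conicLift (AdjoinRoot.of _ X) (AdjoinRoot.root _)
      (adjoinRoot_conic_equation hb))
    (AdjoinRoot.liftAlgHom _ (aeval (conicX k a b)) (conicY k a b) (by
      simp only [conicPoly, eval₂_sub, eval₂_pow, eval₂_X, eval₂_C]
      exact sub_eq_zero.2 (conic_sq_eq hb conic_equation)))
    (by
      apply AdjoinRoot.algHom_ext'
      · apply Polynomial.algHom_ext
        simp [conicLift_conicX]
      · simp [conicLift_conicY])
    (by
      apply conicCoordRing_algHom_ext <;> simp [conicLift_conicX, conicLift_conicY])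

theorem conicEquiv_conicX (hb : b ≠ 0) :
    conicEquiv hb (conicX k a b) = AdjoinRoot.of (conicPoly a b) X :=
  conicLift_conicX _ _ (adjoinRoot_conic_equation hb)

theorem conicEquiv_conicY (hb : b ≠ 0) :
    conicEquiv hb (conicY k a b) = AdjoinRoot.root (conicPoly a b) :=
  conicLift_conicY _ _ (adjoinRoot_conic_equation hb)

theorem conicEquiv_apply (hb : b ≠ 0) (p r : k[X]) :
    conicEquiv hb (aeval (conicX k a b) p + aeval (conicX k a b) r * conicY k a b) =
      AdjoinRoot.mk (conicPoly a b) (C p + C r * X) := by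
  have hof : ∀ p : k[X], conicEquiv hb (aeval (conicX k a b) p) =
      AdjoinRoot.of (conicPoly a b) p := by
    intro p
    refine (aeval_algHom_apply (conicEquiv hb).toAlgHom _ p).symm.trans ?_
    change aeval (conicEquiv hb (conicX k a b)) p = _
    rw [conicEquiv_conicX]
    exact (aeval_algHom_apply (AdjoinRoot.ofAlgHom k (conicPoly a b)) X p).trans
      (by rw [aeval_X_left_apply]; rfl)
  rw [map_add, map_mul, hof, hof, conicEquiv_conicY]
  simp

theorem isDomain_conicCoordRing (h2 : (2 : k) ≠ 0) (ha : a ≠ 0) (hb : b ≠ 0) :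
    IsDomain (conicCoordRing k a b) :=
  haveI := AdjoinRoot.isDomain_of_prime (conicPoly_prime h2 ha hb)
  (conicEquiv hb).toMulEquiv.isDomain _

theorem exists_conic_repr (hb : b ≠ 0) (z : conicCoordRing k a b) :
    ∃ p r : k[X], z = aeval (conicX k a b) p + aeval (conicX k a b) r * conicY k a b := by
  obtain ⟨g, hg⟩ := AdjoinRoot.mk_surjective (conicEquiv hb z)
  have hdeg : (g %ₘ conicPoly a b).natDegree ≤ 1 := by
    have := natDegree_modByMonic_lt g (conicPoly_monic (a := a) (b := b)) (by
      intro h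
      have := conicPoly_natDegree (a := a) (b := b)
      simp [h] at this)
    rw [conicPoly_natDegree] at this
    omega
  have hmk : AdjoinRoot.mk (conicPoly a b) (g %ₘ conicPoly a b) = conicEquiv hb z := by
    rw [← hg, AdjoinRoot.mk_eq_mk, ← dvd_neg, neg_sub]
    exact ⟨g /ₘ conicPoly a b, by
      linear_combination -modByMonic_add_div g (conicPoly a b)⟩
  rw [eq_X_add_C_of_natDegree_le_one hdeg, add_comm, ← conicEquiv_apply hb] at hmk
  exact ⟨_, _, ((conicEquiv hb).injective hmk).symm⟩

theorem conic_repr_eq_zero (hb : b ≠ 0) {p r : k[X]}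
    (h : aeval (conicX k a b) p + aeval (conicX k a b) r * conicY k a b = 0) :
    p = 0 ∧ r = 0 := by
  have h1 := congrArg (conicEquiv hb) h
  rw [map_zero, conicEquiv_apply] at h1
  have h0 : C p + C r * X = 0 := by
    by_contra hne
    refine AdjoinRoot.mk_ne_zero_of_natDegree_lt conicPoly_monic hne ?_ h1
    rw [conicPoly_natDegree]
    have : (C p + C r * X).natDegree ≤ 1 := by compute_degree
    omega
  have hp := congrArg (coeff · 0) h0
  have hr := congrArg (coeff · 1) h0
  simp [coeff_C] at hp hr
  exact ⟨hp, hr⟩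

end ConicRing
section ConicFunctionField

open Polynomial

variable {k : Type*} [Field k] {a b c d : k}

theorem aeval_mem_intermediateField {L : Type*} [Field L] [Algebra k L]
    (M : IntermediateField k L) {x : L} (hx : x ∈ M) (p : k[X]) : aeval x p ∈ M :=
  Algebra.adjoin_le (S := M.toSubalgebra) (by simpa using hx) (aeval_mem_adjoin_singleton k x)

/-- A field generated by the coordinates of a point on the conic, and not algebraic over `k`, is the
function field of the conic. -/
theorem nonempty_conicFunctionField_algEquiv (h2 : (2 : k) ≠ 0) (hc : c ≠ 0) (hd : d ≠ 0)
    {L : Type*} [Field L] [Algebra k L] (x y t : L)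
    (h : algebraMap k L c * x ^ 2 + algebraMap k L d * y ^ 2 = 1)
    (htop : IntermediateField.adjoin k {x, y} = ⊤) (ht : Transcendental k t) :
    Nonempty (conicFunctionField k c d ≃ₐ[k] L) := by
  have := isDomain_conicCoordRing h2 hc hd
  have hy := conic_sq_eq hd h
  have hx : Transcendental k x := by
    intro hx
    apply ht
    have hxm : x ∈ algebraicClosure k L := mem_algebraicClosure_iff.2 hx
    have hym : y ∈ algebraicClosure k L := by
      rw [mem_algebraicClosure_iff]
      refine IsAlgebraic.of_pow two_pos ?_
      rw [hy, ← mem_algebraicClosure_iff]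
      exact aeval_mem_intermediateField _ hxm _
    have hle : IntermediateField.adjoin k {x, y} ≤ algebraicClosure k L := by
      rw [IntermediateField.adjoin_le_iff]
      rintro z (rfl | rfl)
      · exact hxm
      · exact hym
    rw [htop] at hle
    exact mem_algebraicClosure_iff.1 (hle trivial)
  have hinj : Function.Injective (conicLift x y h) := by
    rw [injective_iff_map_eq_zero]
    intro z hz
    obtain ⟨p, r, rfl⟩ := exists_conic_repr hd z
    rw [map_add, map_mul, ← aeval_algHom_apply, ← aeval_algHom_apply, conicLift_conicX,
      conicLift_conicY] at hz
    set δ : k[X] := C d⁻¹ * (1 - C c * X ^ 2) with hδ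
    have hpr : p ^ 2 - r ^ 2 * δ = 0 := by
      apply transcendental_iff.1 hx
      rw [map_sub, map_mul, map_pow, map_pow, ← hy]
      linear_combination (aeval x p - aeval x r * y) * hz
    have hprod : (aeval (conicX k c d) p + aeval (conicX k c d) r * conicY k c d) *
        (aeval (conicX k c d) p + aeval (conicX k c d) (-r) * conicY k c d) = 0 := by
      have h1 := congrArg (aeval (conicX k c d)) hpr
      rw [map_sub, map_mul, map_pow, map_pow, ← conic_sq_eq hd conic_equation, map_zero] at h1
      rw [map_neg]
      linear_combination h1
    rcases mul_eq_zero.1 hprod with h0 | h0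
    · exact h0
    · obtain ⟨rfl, hr⟩ := conic_repr_eq_zero hd h0
      simp [neg_eq_zero.1 hr]
  let φ : conicFunctionField k c d →ₐ[k] L := IsFractionRing.liftAlgHom hinj
  have hφ : ∀ z, φ (algebraMap _ _ z) = conicLift x y h z := fun z =>
    IsFractionRing.lift_algebraMap hinj z
  refine ⟨AlgEquiv.ofBijective φ ⟨φ.toRingHom.injective, ?_⟩⟩
  rw [← AlgHom.fieldRange_eq_top, ← top_le_iff, ← htop, IntermediateField.adjoin_le_iff]
  rintro z (rfl | rfl)
  · exact ⟨_, (hφ _).trans (conicLift_conicX _ _ _)⟩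
  · exact ⟨_, (hφ _).trans (conicLift_conicY _ _ _)⟩

theorem conicFunctionField_equation :
    algebraMap k _ a * algebraMap _ (conicFunctionField k a b) (conicX k a b) ^ 2 +
      algebraMap k _ b * algebraMap _ (conicFunctionField k a b) (conicY k a b) ^ 2 = 1 := by
  have h := congrArg (algebraMap _ (conicFunctionField k a b)) (conic_equation (a := a) (b := b))
  rw [map_add, map_mul, map_mul, map_pow, map_pow, map_one] at h
  exact h

theorem transcendental_conicX (hb : b ≠ 0) :
    Transcendental k (algebraMap _ (conicFunctionField k a b) (conicX k a b)) := by
  rw [transcendental_iff]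
  intro p hp
  rw [aeval_algebraMap_apply, map_eq_zero_iff _ (IsFractionRing.injective _ _)] at hp
  exact (conic_repr_eq_zero hb (p := p) (r := 0) (by simpa using hp)).1

section PureFrame

variable {R : Type*} [CommRing R] (C D : R) (u v : Fin 3 → R) (x y z : R)

theorem pureSq_frame (huv : pureBilin C D u v = 0) :
    pureSq C D (x • u + y • v + z • pureCross C D u v) =
      pureSq C D u * x ^ 2 + pureSq C D v * y ^ 2 - pureSq C D u * pureSq C D v * z ^ 2 := by
  have h1 := pureSq_pureCross C D u v
  have h2 := pureBilin_pureCross_left C D u v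
  have h3 := pureBilin_pureCross_right C D u v
  generalize pureCross C D u v = w at *
  simp only [pureSq, pureBilin, Pi.add_apply, Pi.smul_apply, smul_eq_mul] at *
  linear_combination 2 * x * y * huv + 2 * x * z * h2 + 2 * y * z * h3 + z ^ 2 * h1 +
    z ^ 2 * (C * u 0 * v 0 + D * u 1 * v 1 - C * D * u 2 * v 2) * huv

theorem pureBilin_frame_left (huv : pureBilin C D u v = 0) :
    pureBilin C D u (x • u + y • v + z • pureCross C D u v) = pureSq C D u * x := by
  have h2 := pureBilin_pureCross_left C D u v
  generalize pureCross C D u v = w at *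
  simp only [pureSq, pureBilin, Pi.add_apply, Pi.smul_apply, smul_eq_mul] at *
  linear_combination y * huv + z * h2

theorem pureBilin_frame_right (huv : pureBilin C D u v = 0) :
    pureBilin C D v (x • u + y • v + z • pureCross C D u v) = pureSq C D v * y := by
  have h2 := pureBilin_pureCross_right C D u v
  generalize pureCross C D u v = w at *
  simp only [pureSq, pureBilin, Pi.add_apply, Pi.smul_apply, smul_eq_mul] at *
  linear_combination x * huv + z * h2

theorem pureBilin_frame_cross (huv : pureBilin C D u v = 0) :
    pureBilin C D (pureCross C D u v) (x • u + y • v + z • pureCross C D u v) =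
      -(pureSq C D u * pureSq C D v) * z := by
  have h1 := pureSq_pureCross C D u v
  have h2 := pureBilin_pureCross_left C D u v
  have h3 := pureBilin_pureCross_right C D u v
  rw [huv] at h1
  generalize pureCross C D u v = w at *
  simp only [pureSq, pureBilin, Pi.add_apply, Pi.smul_apply, smul_eq_mul] at *
  linear_combination x * h2 + y * h3 + z * h1

end PureFrame

theorem adjoin_conic_eq_top (h2 : (2 : k) ≠ 0) (ha : a ≠ 0) (hb : b ≠ 0) :
    haveI := isDomain_conicCoordRing h2 ha hb
    ∀ M : IntermediateField k (conicFunctionField k a b),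
      algebraMap _ (conicFunctionField k a b) (conicX k a b) ∈ M →
      algebraMap _ (conicFunctionField k a b) (conicY k a b) ∈ M → M = ⊤ := by
  have := isDomain_conicCoordRing h2 ha hb
  intro M hx hy
  have hR : ∀ z, algebraMap (conicCoordRing k a b) (conicFunctionField k a b) z ∈ M := by
    intro z
    obtain ⟨p, r, rfl⟩ := exists_conic_repr hb z
    rw [map_add, map_mul, ← aeval_algebraMap_apply, ← aeval_algebraMap_apply]
    exact add_mem (aeval_mem_intermediateField M hx _)
      (mul_mem (aeval_mem_intermediateField M hx _) hy)
  rw [← top_le_iff]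
  intro z _
  obtain ⟨s, t, -, rfl⟩ := IsFractionRing.div_surjective (A := conicCoordRing k a b) z
  exact div_mem (hR s) (hR t)

theorem HasPurePair.nonempty_conicFunctionField_algEquiv (h2 : (2 : k) ≠ 0) (ha : a ≠ 0)
    (hb : b ≠ 0) (hc : c ≠ 0) (hd : d ≠ 0) (h : HasPurePair a b c d) :
    Nonempty (conicFunctionField k c d ≃ₐ[k] conicFunctionField k a b) := by
  have := isDomain_conicCoordRing h2 ha hb
  obtain ⟨u, v, hu, hv, huv⟩ := h
  let K := conicFunctionField k a b
  let f : k →+* K := algebraMap k K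
  set x : K := algebraMap _ K (conicX k a b)
  set y : K := algebraMap _ K (conicY k a b)
  have hxy : f a * x ^ 2 + f b * y ^ 2 = 1 := conicFunctionField_equation
  have hf : ∀ {z}, z ≠ 0 → f z ≠ 0 := fun hz => (map_ne_zero f).2 hz
  have hu' : pureSq (f c) (f d) (f ∘ u) = f a :=
    (show _ = f (pureSq c d u) by simp [pureSq]).trans (congrArg f hu)
  have hv' : pureSq (f c) (f d) (f ∘ v) = f b :=
    (show _ = f (pureSq c d v) by simp [pureSq]).trans (congrArg f hv)
  have huv' : pureBilin (f c) (f d) (f ∘ u) (f ∘ v) = 0 := by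
    rw [← map_zero f, ← huv]; simp [pureBilin]
  set w : Fin 3 → K := pureCross (f c) (f d) (f ∘ u) (f ∘ v) with hw
  set p : Fin 3 → K := (f b * y) • (f ∘ u) + (f a * x) • (f ∘ v) + (1 : K) • w with hp
  have hpq := pureSq_frame (f c) (f d) (f ∘ u) (f ∘ v) (f b * y) (f a * x) 1 huv'
  have hpu := pureBilin_frame_left (f c) (f d) (f ∘ u) (f ∘ v) (f b * y) (f a * x) 1 huv'
  have hpv := pureBilin_frame_right (f c) (f d) (f ∘ u) (f ∘ v) (f b * y) (f a * x) 1 huv'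
  have hpw := pureBilin_frame_cross (f c) (f d) (f ∘ u) (f ∘ v) (f b * y) (f a * x) 1 huv'
  rw [← hw, ← hp, hu', hv'] at hpq hpw
  rw [← hw, ← hp, hu'] at hpu
  rw [← hw, ← hp, hv'] at hpv
  have hp2 : p 2 ≠ 0 := by
    intro h0
    have hrepr : aeval (conicX k a b) (C (a * v 2) * X + C (u 0 * v 1 - u 1 * v 0)) +
        aeval (conicX k a b) (C (b * u 2)) * conicY k a b = 0 := by
      apply IsFractionRing.injective (conicCoordRing k a b) K
      rw [map_zero, ← h0, map_add, map_mul (algebraMap (conicCoordRing k a b) K),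
        ← aeval_algebraMap_apply, ← aeval_algebraMap_apply]
      change aeval x _ + aeval x _ * y = _
      simp only [hp, hw, pureCross, Pi.add_apply, Pi.smul_apply, smul_eq_mul, Matrix.cons_val,
        Function.comp_apply, one_mul, map_add, map_mul, map_sub, aeval_C, aeval_X]
      change f a * f (v 2) * x + (f (u 0) * f (v 1) - f (u 1) * f (v 0)) + f b * f (u 2) * y = _
      ring
    obtain ⟨h1, h3⟩ := conic_repr_eq_zero hb hrepr
    have hw2 := congrArg (coeff · 0) h1
    have hv2 := congrArg (coeff · 1) h1
    simp [-map_sub, -map_mul, coeff_C] at hw2 hv2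
    have hu2 : u 2 = 0 := by simpa [hb] using h3
    have hv2 : v 2 = 0 := by simpa [ha] using hv2
    have hcr := pureSq_pureCross c d u v
    rw [hu, hv, huv] at hcr
    have : a * b = 0 := by
      simp only [pureSq, pureCross, Matrix.cons_val, hu2, hv2] at hcr
      linear_combination hcr + c * d * (u 0 * v 1 - u 1 * v 0) * hw2
    exact mul_ne_zero ha hb this
  set x' : K := p 1 / (f c * p 2) with hx'
  set y' : K := p 0 / (f d * p 2) with hy'
  have hp1 : p 1 = f c * x' * p 2 := by
    rw [hx', mul_right_comm, mul_div_cancel₀ _ (mul_ne_zero (hf hc) hp2)]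
  have hp0 : p 0 = f d * y' * p 2 := by
    rw [hy', mul_right_comm, mul_div_cancel₀ _ (mul_ne_zero (hf hd) hp2)]
  have hmem : ∀ z : k, f z ∈ IntermediateField.adjoin k {x', y'} := fun z =>
    IntermediateField.algebraMap_mem _ z
  have hx'm : x' ∈ IntermediateField.adjoin k {x', y'} :=
    IntermediateField.subset_adjoin _ _ (by simp)
  have hy'm : y' ∈ IntermediateField.adjoin k {x', y'} :=
    IntermediateField.subset_adjoin _ _ (by simp)
  -- The coordinates of the old point are ratios of linear forms in the new one.
  have hfactor : ∀ s : Fin 3 → K, pureBilin (f c) (f d) s p =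
      p 2 * (f c * f d * (s 0 * y' + s 1 * x' - s 2)) := by
    intro s
    simp only [pureBilin]
    rw [hp1, hp0]
    ring
  have hformMem : ∀ s : Fin 3 → K, (∀ i, s i ∈ IntermediateField.adjoin k {x', y'}) →
      f c * f d * (s 0 * y' + s 1 * x' - s 2) ∈ IntermediateField.adjoin k {x', y'} := by
    intro s hs
    exact mul_mem (mul_mem (hmem c) (hmem d))
      (sub_mem (add_mem (mul_mem (hs 0) hy'm) (mul_mem (hs 1) hx'm)) (hs 2))
  have hU := hformMem (f ∘ u) (fun i => hmem _)
  have hV := hformMem (f ∘ v) (fun i => hmem _)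
  have hW := hformMem w (fun i => by
    have : w i = f (pureCross c d u v i) := by
      fin_cases i <;> simp [hw, pureCross]
    rw [this]
    exact hmem _)
  rw [hfactor] at hpu hpv hpw
  generalize f c * f d * ((f ∘ u) 0 * y' + (f ∘ u) 1 * x' - (f ∘ u) 2) = mu at *
  generalize f c * f d * ((f ∘ v) 0 * y' + (f ∘ v) 1 * x' - (f ∘ v) 2) = mv at *
  generalize f c * f d * (w 0 * y' + w 1 * x' - w 2) = mw at *
  have hab : f a * f b ≠ 0 := mul_ne_zero (hf ha) (hf hb)
  have hmw : mw ≠ 0 := by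
    rintro rfl
    apply hab
    linear_combination hpw
  have hxm : x = -mv / mw := by
    rw [eq_div_iff hmw]
    refine mul_left_cancel₀ (mul_ne_zero hp2 hab) ?_
    linear_combination f a * f b * x * hpw + f a * f b * hpv
  have hym : y = -mu / mw := by
    rw [eq_div_iff hmw]
    refine mul_left_cancel₀ (mul_ne_zero hp2 hab) ?_
    linear_combination f a * f b * y * hpw + f a * f b * hpu
  refine _root_.nonempty_conicFunctionField_algEquiv h2 hc hd x' y' x ?_ ?_
    (transcendental_conicX hb)
  · change f c * x' ^ 2 + f d * y' ^ 2 = 1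
    have hz : pureSq (f c) (f d) p = 0 := by
      rw [hpq]
      linear_combination f a * f b * hxy
    rw [pureSq, hp1, hp0] at hz
    refine mul_left_cancel₀ (mul_ne_zero (mul_ne_zero (hf hc) (hf hd)) (pow_ne_zero 2 hp2)) ?_
    linear_combination hz
  · refine adjoin_conic_eq_top h2 ha hb _ ?_ ?_
    · change x ∈ _
      rw [hxm]
      exact div_mem (neg_mem hV) hW
    · change y ∈ _
      rw [hym]
      exact div_mem (neg_mem hU) hW

theorem PureAnisotropic.hasPurePair_of_algEquiv (h2 : (2 : k) ≠ 0) (ha : a ≠ 0) (hb : b ≠ 0)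
    (h : PureAnisotropic c d)
    (e : conicFunctionField k c d ≃ₐ[k] conicFunctionField k a b) : HasPurePair a b c d := by
  have := isDomain_conicCoordRing h2 ha hb
  have heq := congrArg e (conicFunctionField_equation (a := c) (b := d))
  rw [map_add, map_mul, map_mul, map_pow, map_pow, map_one, e.commutes, e.commutes] at heq
  obtain ⟨p, s, hs, hps⟩ := IsFractionRing.div_surjective (A := conicCoordRing k a b)
    (e (algebraMap _ _ (conicX k c d)))
  obtain ⟨q, t, ht, hqt⟩ := IsFractionRing.div_surjective (A := conicCoordRing k a b)
    (e (algebraMap _ _ (conicY k c d)))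
  rw [← hps, ← hqt] at heq
  have hs0 := nonZeroDivisors.ne_zero hs
  have ht0 := nonZeroDivisors.ne_zero ht
  set f := algebraMap k (conicCoordRing k a b) with hf
  let z : Fin 3 → conicCoordRing k a b := ![f d * q * s, f c * p * t, s * t]
  have hz : pureSq (f c) (f d) z = 0 := by
    have hs1 := (map_ne_zero_iff (algebraMap (conicCoordRing k a b) (conicFunctionField k a b))
      (IsFractionRing.injective _ _)).2 hs0
    have ht1 := (map_ne_zero_iff (algebraMap (conicCoordRing k a b) (conicFunctionField k a b))
      (IsFractionRing.injective _ _)).2 ht0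
    have hpt : f c * (p * t) ^ 2 + f d * (q * s) ^ 2 = (s * t) ^ 2 := by
      apply IsFractionRing.injective (conicCoordRing k a b) (conicFunctionField k a b)
      rw [IsScalarTower.algebraMap_apply k (conicCoordRing k a b) (conicFunctionField k a b),
        IsScalarTower.algebraMap_apply k (conicCoordRing k a b) (conicFunctionField k a b)] at heq
      simp only [map_add, map_mul, map_pow]
      field_simp at heq
      linear_combination heq
    simp only [pureSq, z, Matrix.cons_val]
    linear_combination f c * f d * hpt
  choose v w hvw using fun i => exists_conic_repr hb (z i)
  have hy := conic_sq_eq hb (conic_equation (a := a) (b := b))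
  have hexp : aeval (conicX k a b) (pureSq (C c) (C d) v +
      C b⁻¹ * (1 - C a * X ^ 2) * pureSq (C c) (C d) w) +
      aeval (conicX k a b) (2 * pureBilin (C c) (C d) v w) * conicY k a b = 0 := by
    rw [map_add, map_mul _ (C b⁻¹ * _), ← hy, ← hz]
    simp only [pureSq, pureBilin, hvw, map_add, map_sub, map_mul, map_pow, aeval_C, map_ofNat]
    ring
  obtain ⟨h1, h3⟩ := conic_repr_eq_zero hb hexp
  have h2' : (2 : k[X]) ≠ 0 := by
    rw [← map_ofNat C 2]
    exact C_ne_zero.2 h2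
  refine h.hasPurePair h2 hb v w ?_ h1 ((mul_eq_zero.1 h3).resolve_left h2')
  by_contra! hcon
  have : z 2 = 0 := by rw [hvw, hcon.1, hcon.2]; simp
  exact mul_ne_zero hs0 ht0 this

end ConicFunctionField

theorem stmt_3 (k : Type u) [Field k] (h2 : (2 : k) ≠ 0) (a b c d : k)
    (ha : a ≠ 0) (hb : b ≠ 0) (hc : c ≠ 0) (hd : d ≠ 0) :
    Nonempty (conicFunctionField k a b ≃ₐ[k] conicFunctionField k c d) ↔
      Nonempty ((ℍ[k,a,b]) ≃ₐ[k] (ℍ[k,c,d])) := by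
  constructor
  · rintro ⟨e⟩
    by_cases hcd : PureAnisotropic c d
    · exact (hcd.hasPurePair_of_algEquiv h2 ha hb e.symm).nonempty_algEquiv h2 ha hb
    by_cases hab : PureAnisotropic a b
    · exact ((hab.hasPurePair_of_algEquiv h2 hc hd e).nonempty_algEquiv h2 hc hd).map
        AlgEquiv.symm
    · have h1 : (-1 : k) ≠ 0 := neg_ne_zero.2 one_ne_zero
      obtain ⟨e₁⟩ := (hasPurePair_one_neg_one h2 ha hb hab).nonempty_algEquiv h2 one_ne_zero h1
      obtain ⟨e₂⟩ := (hasPurePair_one_neg_one h2 hc hd hcd).nonempty_algEquiv h2 one_ne_zero h1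
      exact ⟨e₁.symm.trans e₂⟩
  · rintro ⟨f⟩
    exact ((hasPurePair_of_algEquiv h2 ha hb f).nonempty_conicFunctionField_algEquiv
      h2 ha hb hc hd).map AlgEquiv.symm

end
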